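/- Labelled threshold direct product theorem: there exist universal constants c ∈ (1/2, 1) and c' > 0 such that for every (possibly partial) function f : X → {0,1} with X ⊆ {0,1}^m, every n ∈ ℕ, every integer k with 1 ≤ k ≤ n, and every γ ∈ [c, 1), the worst-case randomized query complexity of the k-of-n labelled threshold task satisfies R_{γ^k}(Label_k^n ∘ f) ≥ c'·k·R(f), where R(f) = R_{2/3}(f). -/

import Mathlib

open Finset

/-- Deterministic decision trees querying coordinates `i : ι` of inputs `x : ι → Bool`,
with leaves labelled by elements of `L`. -/
inductive DTree (ι : Type) (L : Type) : Type
  | leaf (lab : L) : DTree ι L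
  | node (i : ι) (t0 : DTree ι L) (t1 : DTree ι L) : DTree ι L

namespace DTree

variable {ι L : Type}

/-- Output label at the leaf reached by input `x`. -/
def out : DTree ι L → (ι → Bool) → L
  | .leaf lab, _ => lab
  | .node i t0 t1, x => if x i then out t1 x else out t0 x

/-- Number of queries made on input `x` (depth of the leaf reached by `x`). -/
def cost : DTree ι L → (ι → Bool) → ℕ
  | .leaf _, _ => 0
  | .node i t0 t1, x => (if x i then cost t1 x else cost t0 x) + 1

/-- Maximum leaf depth of the tree. -/
def depth : DTree ι L → ℕ
  | .leaf _ => 0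
  | .node _ t0 t1 => max (depth t0) (depth t1) + 1

/-- The set of inputs reaching the same leaf as input `x`. -/
def leafSet : DTree ι L → (ι → Bool) → Set (ι → Bool)
  | .leaf _, _ => Set.univ
  | .node i t0 t1, x => {y | y i = x i} ∩ (if x i then leafSet t1 x else leafSet t0 x)

/-- Every leaf label of the tree satisfies the predicate `P`. -/
def allLabels : DTree ι L → (L → Prop) → Prop
  | .leaf lab, P => P lab
  | .node _ t0 t1, P => allLabels t0 P ∧ allLabels t1 P

end DTree

/-- A randomized query algorithm: a finitely supported probability distribution over
deterministic decision trees. -/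
structure RandAlg (ι : Type) (L : Type) where
  k : ℕ
  p : Fin k → ℝ
  T : Fin k → DTree ι L
  p_nonneg : ∀ j, 0 ≤ p j
  p_sum : ∑ j, p j = 1

/-- A probability distribution on inputs, supported inside the domain `X`. -/
structure InputDist (ι : Type) [Fintype ι] [DecidableEq ι] (X : Set (ι → Bool)) where
  μ : (ι → Bool) → ℝ
  nonneg : ∀ x, 0 ≤ μ x
  sum_one : ∑ x, μ x = 1
  supp : ∀ x, x ∉ X → μ x = 0

/-- A score function `φ : [0,1] → [1/2,1]`. -/
structure ScoreFun where
  φ : ℝ → ℝ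
  continuous : ContinuousOn φ (Set.Icc 0 1)
  half_le : ∀ p ∈ Set.Icc (0:ℝ) 1, 1 / 2 ≤ φ p
  le_one : ∀ p ∈ Set.Icc (0:ℝ) 1, φ p ≤ 1
  map_zero : φ 0 = 1
  map_one : φ 1 = 1
  map_half : φ (1 / 2) = 1 / 2
  symm : ∀ p ∈ Set.Icc (0:ℝ) 1, φ (1 - p) = φ p
  mono : MonotoneOn φ (Set.Icc (1 / 2) 1)

section Defs

variable {ι L : Type} [Fintype ι] [DecidableEq ι]

/-- Mass of a set of inputs under the weight function `μ`. -/
noncomputable def mass (μ : (ι → Bool) → ℝ) (S : Set (ι → Bool)) : ℝ :=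
  ∑ x, Set.indicator S μ x

/-- Score `φ(μ(ℓ₁)/μ(ℓ))` of the leaf `ℓ` reached by `x` in the tree `t`. -/
noncomputable def leafScore (S : ScoreFun) (f : (ι → Bool) → Bool) (μ : (ι → Bool) → ℝ)
    (t : DTree ι L) (x : ι → Bool) : ℝ :=
  S.φ (mass μ (t.leafSet x ∩ {y | f y = true}) / mass μ (t.leafSet x))

/-- Score of a randomized algorithm: `E_{D∼R, x∼μ}[score(D(x))]`. -/
noncomputable def algScore (S : ScoreFun) (f : (ι → Bool) → Bool) (μ : (ι → Bool) → ℝ)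
    (R : RandAlg ι L) : ℝ :=
  ∑ j, R.p j * ∑ x, μ x * leafScore S f μ (R.T j) x

/-- Expected cost `E_{D∼R, x∼μ}[cost(D(x))]`. -/
noncomputable def expCost (μ : (ι → Bool) → ℝ) (R : RandAlg ι L) : ℝ :=
  ∑ j, R.p j * ∑ x, μ x * ((R.T j).cost x : ℝ)

/-- Score-weighted cost `E[score(D(x))·cost(D(x))] / E[score(D(x))]`. -/
noncomputable def scost (S : ScoreFun) (f : (ι → Bool) → Bool) (μ : (ι → Bool) → ℝ)
    (R : RandAlg ι L) : ℝ :=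
  (∑ j, R.p j * ∑ x, μ x * (leafScore S f μ (R.T j) x * ((R.T j).cost x : ℝ))) /
    algScore S f μ R

/-- Discounted score `E[score(D(x))·e^{-α·cost(D(x))}]`. -/
noncomputable def dScore (S : ScoreFun) (f : (ι → Bool) → Bool) (μ : (ι → Bool) → ℝ)
    (α : ℝ) (R : RandAlg ι L) : ℝ :=
  ∑ j, R.p j * ∑ x, μ x *
    (leafScore S f μ (R.T j) x * Real.exp (-(α * ((R.T j).cost x : ℝ))))

/-- Maximum discounted score `DS_α^μ(f)`. -/
noncomputable def DS (S : ScoreFun) (f : (ι → Bool) → Bool) (μ : (ι → Bool) → ℝ)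
    (α : ℝ) : ℝ :=
  ⨆ R : RandAlg ι Unit, dScore S f μ α R

/-- Distributional score-weighted query complexity `sR̄̄_γ^μ(f)`. -/
noncomputable def sRdist (S : ScoreFun) (f : (ι → Bool) → Bool) (μ : (ι → Bool) → ℝ)
    (γ : ℝ) : ℝ :=
  sInf {c | ∃ R : RandAlg ι Unit, γ ≤ algScore S f μ R ∧ scost S f μ R = c}

/-- Distributional query complexity `R̄̄_γ^μ(f)` (expected cost). -/
noncomputable def Rdist (S : ScoreFun) (f : (ι → Bool) → Bool) (μ : (ι → Bool) → ℝ)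
    (γ : ℝ) : ℝ :=
  sInf {c | ∃ R : RandAlg ι Unit, γ ≤ algScore S f μ R ∧ expCost μ R = c}

/-- Maximum score-weighted distributional query complexity `sR̄̄_γ(f)`. -/
noncomputable def sRmax (S : ScoreFun) (X : Set (ι → Bool)) (f : (ι → Bool) → Bool)
    (γ : ℝ) : ℝ :=
  ⨆ μ : InputDist ι X, sRdist S f μ.μ γ

/-- Maximum distributional query complexity `R̄̄_γ(f)`. -/
noncomputable def Rmax (S : ScoreFun) (X : Set (ι → Bool)) (f : (ι → Bool) → Bool)
    (γ : ℝ) : ℝ :=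
  ⨆ μ : InputDist ι X, Rdist S f μ.μ γ

/-- Success-probability score `max{μ(ℓ₀),μ(ℓ₁)}/μ(ℓ)` of the leaf reached by `x`. -/
noncomputable def succLeafScore (f : (ι → Bool) → Bool) (μ : (ι → Bool) → ℝ)
    (t : DTree ι L) (x : ι → Bool) : ℝ :=
  max (mass μ (t.leafSet x ∩ {y | f y = false})) (mass μ (t.leafSet x ∩ {y | f y = true})) /
    mass μ (t.leafSet x)

/-- Success-probability score of a randomized algorithm. -/
noncomputable def succAlgScore (f : (ι → Bool) → Bool) (μ : (ι → Bool) → ℝ)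
    (R : RandAlg ι L) : ℝ :=
  ∑ j, R.p j * ∑ x, μ x * succLeafScore f μ (R.T j) x

/-- Distributional query complexity with the success-probability score. -/
noncomputable def succRdist (f : (ι → Bool) → Bool) (μ : (ι → Bool) → ℝ) (γ : ℝ) : ℝ :=
  sInf {c | ∃ R : RandAlg ι Unit, γ ≤ succAlgScore f μ R ∧ expCost μ R = c}

/-- Maximum distributional query complexity `R̄̄_γ(f)` with the success-probability score. -/
noncomputable def succRmax (X : Set (ι → Bool)) (f : (ι → Bool) → Bool) (γ : ℝ) : ℝ :=
  ⨆ μ : InputDist ι X, succRdist f μ.μ γ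

/-- The fraction `q = μ(ℓ₁)/μ(ℓ)` at the leaf reached by `x`. -/
noncomputable def leafBias (f : (ι → Bool) → Bool) (μ : (ι → Bool) → ℝ)
    (t : DTree ι L) (x : ι → Bool) : ℝ :=
  mass μ (t.leafSet x ∩ {y | f y = true}) / mass μ (t.leafSet x)

/-- Hellinger loss `E[2·√(q(1-q))]` of a randomized algorithm. -/
noncomputable def helLossAlg (f : (ι → Bool) → Bool) (μ : (ι → Bool) → ℝ)
    (R : RandAlg ι L) : ℝ :=
  ∑ j, R.p j * ∑ x, μ x *
    (2 * Real.sqrt (leafBias f μ (R.T j) x * (1 - leafBias f μ (R.T j) x)))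

/-- Hellinger score `E[1 - √(q(1-q))]` of a randomized algorithm. -/
noncomputable def helScoreAlg (f : (ι → Bool) → Bool) (μ : (ι → Bool) → ℝ)
    (R : RandAlg ι L) : ℝ :=
  ∑ j, R.p j * ∑ x, μ x *
    (1 - Real.sqrt (leafBias f μ (R.T j) x * (1 - leafBias f μ (R.T j) x)))

/-- `R̄̄_{Hel↓,ε}(f)`: maximum distributional complexity at Hellinger loss `ε`. -/
noncomputable def RmaxHelLoss (X : Set (ι → Bool)) (f : (ι → Bool) → Bool) (ε : ℝ) : ℝ :=
  ⨆ μ : InputDist ι X,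
    sInf {c | ∃ R : RandAlg ι Unit, helLossAlg f μ.μ R ≤ ε ∧ expCost μ.μ R = c}

/-- `R̄̄_{Hel,γ}(f)`: maximum distributional complexity at Hellinger score `γ`. -/
noncomputable def RmaxHel (X : Set (ι → Bool)) (f : (ι → Bool) → Bool) (γ : ℝ) : ℝ :=
  ⨆ μ : InputDist ι X,
    sInf {c | ∃ R : RandAlg ι Unit, γ ≤ helScoreAlg f μ.μ R ∧ expCost μ.μ R = c}

/-- Binary entropy function. -/
noncomputable def binEnt (p : ℝ) : ℝ :=
  -(p * Real.logb 2 p) - (1 - p) * Real.logb 2 (1 - p)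

/-- Exponential-entropy score `E[1 - (1/2)·2^{-h(q)}]` of a randomized algorithm. -/
noncomputable def entScoreAlg (f : (ι → Bool) → Bool) (μ : (ι → Bool) → ℝ)
    (R : RandAlg ι L) : ℝ :=
  ∑ j, R.p j * ∑ x, μ x *
    (1 - (1 / 2) * (2:ℝ) ^ (-(binEnt (leafBias f μ (R.T j) x))))

/-- `R̄̄_{Ent,γ}(f)`: maximum distributional complexity at exponential-entropy score `γ`. -/
noncomputable def RmaxEnt (X : Set (ι → Bool)) (f : (ι → Bool) → Bool) (γ : ℝ) : ℝ :=
  ⨆ μ : InputDist ι X,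
    sInf {c | ∃ R : RandAlg ι Unit, γ ≤ entScoreAlg f μ.μ R ∧ expCost μ.μ R = c}

end Defs

section WorstCase

variable {ι L : Type}

open Classical in
/-- Worst-case randomized query complexity for a generic task: minimum, over randomized
algorithms whose leaf labels satisfy `labelOK` and which on every input `x ∈ X` output a
label `z` with `good x z` with probability at least `δ`, of the maximum leaf depth over
the trees in the support. -/
noncomputable def RwcTask (X : Set (ι → Bool)) (good : (ι → Bool) → L → Prop)
    (labelOK : L → Prop) (δ : ℝ) : ℕ :=
  sInf {d : ℕ | ∃ R : RandAlg ι L,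
    (∀ j, R.p j ≠ 0 → (R.T j).allLabels labelOK) ∧
    (∀ x ∈ X, δ ≤ ∑ j, if good x ((R.T j).out x) then R.p j else 0) ∧
    ∀ j, R.p j ≠ 0 → (R.T j).depth ≤ d}

/-- Worst-case randomized query complexity `R_δ(f)` of a (partial) Boolean function. -/
noncomputable def Rwc (X : Set (ι → Bool)) (f : (ι → Bool) → Bool) (δ : ℝ) : ℕ :=
  RwcTask X (fun x b => b = f x) (fun _ : Bool => True) δ

end WorstCase

section Product

variable {m n : ℕ} {L : Type}

/-- The `i`-th block of an input to the `n`-fold direct product. -/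
def block (x : Fin n × Fin m → Bool) (i : Fin n) : Fin m → Bool := fun j => x (i, j)

/-- The product domain `Xⁿ`. -/
def Xpow (n : ℕ) (X : Set (Fin m → Bool)) : Set (Fin n × Fin m → Bool) :=
  {x | ∀ i, block x i ∈ X}

/-- The `n`-fold direct product `fⁿ`. -/
def fpow (f : (Fin m → Bool) → Bool) (x : Fin n × Fin m → Bool) : Fin n → Bool :=
  fun i => f (block x i)

/-- The product distribution `μⁿ`. -/
noncomputable def prodMu (μ : (Fin m → Bool) → ℝ) (x : Fin n × Fin m → Bool) : ℝ :=
  ∏ i, μ (block x i)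

/-- The `i`-th factor `ℓ^(i)` of the (product) leaf reached by `x` in a decision tree for `fⁿ`. -/
def blockSet (t : DTree (Fin n × Fin m) L) (x : Fin n × Fin m → Bool) (i : Fin n) :
    Set (Fin m → Bool) :=
  {y | (fun q : Fin n × Fin m => if q.1 = i then y q.2 else x q) ∈ t.leafSet x}

/-- Score of a leaf of a tree for `fⁿ` under `μⁿ`: the product of the scores of its factors. -/
noncomputable def prodLeafScore (S : ScoreFun) (f : (Fin m → Bool) → Bool)
    (μ : (Fin m → Bool) → ℝ) (t : DTree (Fin n × Fin m) L) (x : Fin n × Fin m → Bool) : ℝ :=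
  ∏ i, S.φ (mass μ (blockSet t x i ∩ {y | f y = true}) / mass μ (blockSet t x i))

/-- Score of a randomized algorithm for `fⁿ` under `μⁿ`. -/
noncomputable def algScoreN (S : ScoreFun) (f : (Fin m → Bool) → Bool)
    (μ : (Fin m → Bool) → ℝ) (R : RandAlg (Fin n × Fin m) L) : ℝ :=
  ∑ j, R.p j * ∑ x, prodMu μ x * prodLeafScore S f μ (R.T j) x

/-- Score-weighted cost of a randomized algorithm for `fⁿ` under `μⁿ`. -/
noncomputable def scostN (S : ScoreFun) (f : (Fin m → Bool) → Bool)
    (μ : (Fin m → Bool) → ℝ) (R : RandAlg (Fin n × Fin m) L) : ℝ :=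
  (∑ j, R.p j * ∑ x, prodMu μ x * (prodLeafScore S f μ (R.T j) x * ((R.T j).cost x : ℝ))) /
    algScoreN S f μ R

/-- Discounted score of a randomized algorithm for `fⁿ` under `μⁿ`. -/
noncomputable def dScoreN (S : ScoreFun) (f : (Fin m → Bool) → Bool)
    (μ : (Fin m → Bool) → ℝ) (α : ℝ) (R : RandAlg (Fin n × Fin m) L) : ℝ :=
  ∑ j, R.p j * ∑ x, prodMu μ x *
    (prodLeafScore S f μ (R.T j) x * Real.exp (-(α * ((R.T j).cost x : ℝ))))

/-- Maximum discounted score `DS_α^{μⁿ}(fⁿ)`. -/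
noncomputable def DSN (S : ScoreFun) (f : (Fin m → Bool) → Bool)
    (μ : (Fin m → Bool) → ℝ) (α : ℝ) (n : ℕ) : ℝ :=
  ⨆ R : RandAlg (Fin n × Fin m) Unit, dScoreN S f μ α R

/-- Distributional score-weighted query complexity `sR̄̄_γ^{μⁿ}(fⁿ)`. -/
noncomputable def sRdistN (S : ScoreFun) (f : (Fin m → Bool) → Bool)
    (μ : (Fin m → Bool) → ℝ) (γ : ℝ) (n : ℕ) : ℝ :=
  sInf {c | ∃ R : RandAlg (Fin n × Fin m) Unit,
    γ ≤ algScoreN S f μ R ∧ scostN S f μ R = c}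

/-- Worst-case randomized query complexity `R_δ(fⁿ)` of computing `fⁿ` exactly. -/
noncomputable def RwcN (X : Set (Fin m → Bool)) (f : (Fin m → Bool) → Bool)
    (n : ℕ) (δ : ℝ) : ℕ :=
  RwcTask (Xpow n X) (fun x z => z = fpow f x) (fun _ : Fin n → Bool => True) δ

/-- Success-probability score `max_z μ(ℓ ∩ (fⁿ)⁻¹(z))/μ(ℓ)` of a leaf of a tree for `fⁿ`
under an arbitrary distribution `μ` on `Xⁿ`. -/
noncomputable def succLeafScoreN (f : (Fin m → Bool) → Bool)
    (μ : (Fin n × Fin m → Bool) → ℝ) (t : DTree (Fin n × Fin m) L)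
    (x : Fin n × Fin m → Bool) : ℝ :=
  (⨆ z : Fin n → Bool, mass μ (t.leafSet x ∩ {y | fpow f y = z})) / mass μ (t.leafSet x)

/-- Success-probability score of a randomized algorithm for `fⁿ`. -/
noncomputable def succAlgScoreN (f : (Fin m → Bool) → Bool)
    (μ : (Fin n × Fin m → Bool) → ℝ) (R : RandAlg (Fin n × Fin m) L) : ℝ :=
  ∑ j, R.p j * ∑ x, μ x * succLeafScoreN f μ (R.T j) x

/-- Score-weighted cost of a randomized algorithm for `fⁿ` (success-probability score). -/
noncomputable def succScostN (f : (Fin m → Bool) → Bool)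
    (μ : (Fin n × Fin m → Bool) → ℝ) (R : RandAlg (Fin n × Fin m) L) : ℝ :=
  (∑ j, R.p j * ∑ x, μ x * (succLeafScoreN f μ (R.T j) x * ((R.T j).cost x : ℝ))) /
    succAlgScoreN f μ R

/-- Maximum score-weighted distributional query complexity `sR̄̄_δ(fⁿ)`
(success-probability score). -/
noncomputable def succSRmaxN (X : Set (Fin m → Bool)) (f : (Fin m → Bool) → Bool)
    (n : ℕ) (δ : ℝ) : ℝ :=
  ⨆ μ : InputDist (Fin n × Fin m) (Xpow n X),
    sInf {c | ∃ R : RandAlg (Fin n × Fin m) Unit,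
      δ ≤ succAlgScoreN f μ.μ R ∧ succScostN f μ.μ R = c}

/-- Worst-case randomized query complexity of the list-decoding task `LD_ℓⁿ ∘ f`. -/
noncomputable def RwcLD (X : Set (Fin m → Bool)) (f : (Fin m → Bool) → Bool)
    (n ℓ : ℕ) (δ : ℝ) : ℕ :=
  RwcTask (Xpow n X) (fun x S => fpow f x ∈ S)
    (fun S : Finset (Fin n → Bool) => S.card = 2 ^ (n - ℓ)) δ

open Classical in
/-- Worst-case randomized query complexity of the threshold task `Thr_kⁿ ∘ f`. -/
noncomputable def RwcThr (X : Set (Fin m → Bool)) (f : (Fin m → Bool) → Bool)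
    (n k : ℕ) (δ : ℝ) : ℕ :=
  RwcTask (Xpow n X)
    (fun x z => k ≤ (Finset.univ.filter fun i => z i = fpow f x i).card)
    (fun _ : Fin n → Bool => True) δ

open Classical in
/-- Worst-case randomized query complexity of the labelled threshold task `Label_kⁿ ∘ f`. -/
noncomputable def RwcLabel (X : Set (Fin m → Bool)) (f : (Fin m → Bool) → Bool)
    (n k : ℕ) (δ : ℝ) : ℕ :=
  RwcTask (Xpow n X)
    (fun x z => ∀ i b, z i = some b → fpow f x i = b)
    (fun z : Fin n → Option Bool =>
      (Finset.univ.filter fun i => (z i).isSome).card = k) δ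

end Product

/-- A set of real vectors containing `0` either is dominated by a probability vector supported
on `X`, or has a convex combination that is strictly positive on `X`. -/
theorem exists_prob_nonpos_or_exists_pos {I : Type} [Fintype I] [DecidableEq I] (X : Set I)
    (V : Set (I → ℝ)) (h0 : 0 ∈ V) :
    (∃ w : I → ℝ, (∀ i, 0 ≤ w i) ∧ ∑ i, w i = 1 ∧ (∀ i, i ∉ X → w i = 0) ∧
      ∀ v ∈ V, ∑ i, w i * v i ≤ 0) ∨
    ∃ v ∈ convexHull ℝ V, ∀ i ∈ X, 0 < v i := by
  by_cases hdis : ∃ v ∈ convexHull ℝ V, ∀ i ∈ X, 0 < v i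
  · exact Or.inr hdis
  left
  push Not at hdis
  set P : Set (I → ℝ) := {v | ∀ i ∈ X, 0 < v i} with hP
  have hPc : Convex ℝ P := by
    intro a ha b hb s t hs ht hst i hi
    have h1 := ha i hi
    have h2 := hb i hi
    simp only [Pi.add_apply, Pi.smul_apply, smul_eq_mul]
    rcases hs.eq_or_lt with rfl | hs'
    · have : t = 1 := by linarith
      subst this; linarith
    · have := mul_pos hs' h1
      have := mul_nonneg ht h2.le
      linarith
  have hPo : IsOpen P := by
    have : P = ⋂ i ∈ X, {v : I → ℝ | 0 < v i} := by ext v; simp [hP]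
    rw [this]
    exact (Set.toFinite X).isOpen_biInter fun i _ =>
      isOpen_lt continuous_const (continuous_apply i)
  obtain ⟨F, u, hF1, hF2⟩ := geometric_hahn_banach_open hPc hPo (convex_convexHull ℝ V) (by
    rw [Set.disjoint_left]
    intro v hv hv'
    obtain ⟨i, hi, hle⟩ := hdis v hv'
    exact absurd (hv i hi) (not_lt.mpr hle))
  have hu0 : u ≤ 0 := by simpa using hF2 0 (subset_convexHull ℝ V h0)
  set a : I → ℝ := fun i => F (Pi.single i 1) with ha
  have hFa : ∀ v : I → ℝ, F v = ∑ i, v i * a i := by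
    intro v
    have := LinearMap.pi_apply_eq_sum_univ (F : (I → ℝ) →ₗ[ℝ] ℝ) v
    simp only [ContinuousLinearMap.coe_coe, smul_eq_mul] at this
    rw [this]
    refine Finset.sum_congr rfl fun i _ => ?_
    rw [ha]
    congr 2
    ext j
    simp [Pi.single_apply, eq_comm]
  have hone : (fun _ => 1 : I → ℝ) ∈ P := fun i _ => one_pos
  have hF1' : F (fun _ => 1) < 0 := lt_of_lt_of_le (hF1 _ hone) hu0
  have hu1 : 0 ≤ u := by
    by_contra hneg
    push Not at hneg
    set s : ℝ := u / (2 * F (fun _ => 1)) with hs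
    have hspos : 0 < s := div_pos_of_neg_of_neg hneg (by linarith)
    have hmem : (s • (fun _ => 1 : I → ℝ)) ∈ P := fun i _ => by simpa using hspos
    have := hF1 _ hmem
    rw [map_smul, smul_eq_mul, hs] at this
    have h2 : u / (2 * F (fun _ => 1)) * F (fun _ => 1) = u / 2 := by
      have hne := hF1'.ne
      field_simp
    rw [h2] at this
    linarith
  have hu : u = 0 := le_antisymm hu0 hu1
  subst hu
  have key : ∀ e : I → ℝ, (∀ i ∈ X, 0 ≤ e i) → F e ≤ 0 := by
    intro e he
    by_contra hpos
    push Not at hpos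
    set s : ℝ := -F (fun _ => 1) / F e with hs
    have hspos : 0 < s := div_pos (by linarith) hpos
    have hmem : ((fun _ => 1 : I → ℝ) + s • e) ∈ P := fun i hi => by
      have := mul_nonneg hspos.le (he i hi)
      simp only [Pi.add_apply, Pi.smul_apply, smul_eq_mul]
      linarith
    have := hF1 _ hmem
    rw [map_add, map_smul, smul_eq_mul, hs, div_mul_cancel₀ _ hpos.ne'] at this
    linarith
  have ha0 : ∀ i, a i ≤ 0 := fun i => key _ fun j _ => by
    by_cases h : j = i
    · subst h; simp
    · simp [h]
  have haX : ∀ i, i ∉ X → a i = 0 := fun i hi => by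
    refine le_antisymm (ha0 i) ?_
    have := key (-Pi.single i 1) fun j hj => by
      have : j ≠ i := fun h => hi (h ▸ hj)
      simp [this]
    rw [map_neg] at this
    simp only [ha]
    linarith
  have hsum : ∑ i, a i < 0 := by simpa [hFa] using hF1'
  refine ⟨fun i => a i / ∑ i, a i, fun i => div_nonneg_of_nonpos (ha0 i) hsum.le, ?_, ?_, ?_⟩
  · rw [← Finset.sum_div, div_self hsum.ne]
  · intro i hi
    simp [haX i hi]
  · intro v hv
    have := hF2 v (subset_convexHull ℝ V hv)
    rw [hFa] at this
    have h2 : ∑ i, a i / (∑ i, a i) * v i = (∑ i, v i * a i) / ∑ i, a i := by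
      rw [Finset.sum_div]
      exact Finset.sum_congr rfl fun i _ => by ring
    rw [h2]
    exact div_nonpos_of_nonneg_of_nonpos this hsum.le

namespace DTree

variable {ι L : Type}

/-- Run the first tree and continue with the second one at the leaves labelled `none`. -/
def orElse : DTree ι (Option L) → DTree ι L → DTree ι L
  | .leaf (some b), _ => .leaf b
  | .leaf none, t => t
  | .node i t0 t1, t => .node i (orElse t0 t) (orElse t1 t)

theorem out_orElse (s : DTree ι (Option L)) (t : DTree ι L) (x : ι → Bool) :
    (s.orElse t).out x = (s.out x).getD (t.out x) := by
  induction s with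
  | leaf o => cases o <;> simp [orElse, out]
  | node i t0 t1 h0 h1 => cases h : x i <;> simp [orElse, out, h, h0, h1]

theorem cost_orElse (s : DTree ι (Option L)) (t : DTree ι L) (x : ι → Bool) :
    (s.orElse t).cost x = s.cost x + if (s.out x).isNone then t.cost x else 0 := by
  induction s with
  | leaf o => cases o <;> simp [orElse, out, cost]
  | node i t0 t1 h0 h1 => cases h : x i <;> simp [orElse, out, cost, h, h0, h1] <;> ring

/-- Cut the tree at depth `d`, answering `b` where it is cut. -/
def trunc (b : L) : DTree ι L → ℕ → DTree ι L
  | .leaf c, _ => .leaf c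
  | .node _ _ _, 0 => .leaf b
  | .node i t0 t1, d + 1 => .node i (trunc b t0 d) (trunc b t1 d)

theorem depth_trunc_le (b : L) (t : DTree ι L) (d : ℕ) : (t.trunc b d).depth ≤ d := by
  induction t generalizing d with
  | leaf c => simp [trunc, depth]
  | node i t0 t1 h0 h1 =>
    cases d with
    | zero => simp [trunc, depth]
    | succ d => simp [trunc, depth, h0, h1]

theorem out_trunc (b : L) (t : DTree ι L) (d : ℕ) (x : ι → Bool) (h : t.cost x ≤ d) :
    (t.trunc b d).out x = t.out x := by
  induction t generalizing d with
  | leaf c => simp [trunc]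
  | node i t0 t1 h0 h1 =>
    cases d with
    | zero => simp [cost] at h
    | succ d =>
      cases hx : x i <;> simp [cost, hx] at h <;> simp [trunc, out, hx, h0, h1, h]

theorem allLabels_true (t : DTree ι L) : t.allLabels fun _ => True := by
  induction t with
  | leaf c => trivial
  | node i t0 t1 h0 h1 => exact ⟨h0, h1⟩

theorem exists_out_eq_of_agree [DecidableEq ι] (g : (ι → Bool) → L) (P : L → Prop)
    (hg : ∀ x, P (g x)) (l : List ι) (y : ι → Bool) :
    ∃ t : DTree ι L, t.allLabels P ∧ ∀ x, (∀ i, i ∉ l → y i = x i) → t.out x = g x := by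
  induction l generalizing y with
  | nil =>
    refine ⟨.leaf (g y), hg y, fun x hx => ?_⟩
    have : y = x := funext fun i => hx i (by simp)
    simp [out, this]
  | cons i l ih =>
    obtain ⟨t0, hl0, h0⟩ := ih (Function.update y i false)
    obtain ⟨t1, hl1, h1⟩ := ih (Function.update y i true)
    refine ⟨.node i t0 t1, ⟨hl0, hl1⟩, fun x hx => ?_⟩
    have aux : ∀ b, x i = b → ∀ j, j ∉ l → Function.update y i b j = x j := by
      intro b hb j hj
      by_cases hji : j = i
      · subst hji; simp [hb]
      · rw [Function.update_of_ne hji]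
        exact hx j (by simp [hji, hj])
    cases hb : x i
    · simpa [out, hb] using h0 x (aux _ hb)
    · simpa [out, hb] using h1 x (aux _ hb)

/-- Every function on a finite cube is computed by some decision tree. -/
theorem exists_out_eq [Fintype ι] [DecidableEq ι] (g : (ι → Bool) → L) (P : L → Prop)
    (hg : ∀ x, P (g x)) : ∃ t : DTree ι L, t.allLabels P ∧ ∀ x, t.out x = g x := by
  obtain ⟨t, ht, h⟩ := exists_out_eq_of_agree g P hg Finset.univ.toList fun _ => false
  exact ⟨t, ht, fun x => h x fun i hi => absurd (by simp) hi⟩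

/-- Payoff of answering an instance with true value `b`: `1` for abstaining, `lam` for a
correct answer, and `0` for a wrong one. -/
noncomputable def gain (lam : ℝ) (b : Bool) : Option Bool → ℝ
  | none => 1
  | some c => if c = b then lam else 0

/-- Payoff of the tree on `x`, minus `α` per query. -/
noncomputable def netGain (lam α : ℝ) (f : (ι → Bool) → Bool) (t : DTree ι (Option Bool))
    (x : ι → Bool) : ℝ :=
  gain lam (f x) (t.out x) - α * t.cost x

end DTree

section HardDistribution

open DTree

/-- Indicator of a correct answer, minus `κ` per query. -/
noncomputable def DTree.penalized {ι : Type} (κ : ℝ) (f : (ι → Bool) → Bool) (t : DTree ι Bool)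
    (x : ι → Bool) : ℝ :=
  (if t.out x = f x then 1 else 0) - κ * t.cost x

/-- Truncating trees whose penalized success probability is at least `δ` gives a worst-case
randomized algorithm. -/
theorem Rwc_lt_of_penalized {ι : Type} (X : Set (ι → Bool)) (f : (ι → Bool) → Bool) (δ : ℝ)
    {r : ℕ} (hr : 0 < r) (u : (ι → Bool) → ℝ)
    (hu : u ∈ convexHull ℝ (Set.range (penalized (r : ℝ)⁻¹ f))) (hδ : ∀ x ∈ X, δ ≤ u x) :
    Rwc X f δ < r := by
  obtain ⟨J, _, w, z, hw, hw1, hz, rfl⟩ := mem_convexHull_iff_exists_fintype.1 hu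
  choose t ht using hz
  let e := Fintype.equivFin J
  have hmem : Rwc X f δ ≤ r - 1 := by
    refine Nat.sInf_le ⟨⟨Fintype.card J, fun j => w (e.symm j),
      fun j => (t (e.symm j)).trunc false (r - 1), fun j => hw _, ?_⟩,
      fun j _ => allLabels_true _, ?_, fun j _ => depth_trunc_le _ _ _⟩
    · rw [← hw1]
      exact e.symm.sum_comp w
    · intro x hx
      refine (hδ x hx).trans ?_
      suffices h : (∑ j, w j • z j) x ≤ ∑ j : Fin (Fintype.card J),
          if ((t (e.symm j)).trunc false (r - 1)).out x = f x then w (e.symm j) else 0 by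
        refine h.trans (le_of_eq ?_)
        congr!
      rw [e.symm.sum_comp
        fun j => if ((t j).trunc false (r - 1)).out x = f x then w j else 0, Finset.sum_apply]
      refine Finset.sum_le_sum fun j _ => ?_
      simp only [Pi.smul_apply, smul_eq_mul, ← ht, penalized]
      have hr' : (0 : ℝ) < r := Nat.cast_pos.2 hr
      have hpos : (0 : ℝ) ≤ (r : ℝ)⁻¹ * (t j).cost x := by positivity
      by_cases hc : (t j).cost x ≤ r - 1
      · rw [out_trunc _ _ _ _ hc]
        split_ifs
        · nlinarith [hw j]
        · nlinarith [hw j]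
      · have h1 : (1 : ℝ) ≤ (r : ℝ)⁻¹ * (t j).cost x := by
          rw [inv_mul_eq_div, one_le_div hr']
          exact_mod_cast (by omega : r ≤ (t j).cost x)
        have h2 : (if (t j).out x = f x then (1 : ℝ) else 0) ≤ 1 := by split_ifs <;> norm_num
        refine le_trans (mul_nonpos_of_nonneg_of_nonpos (hw j) (by linarith)) ?_
        split_ifs
        · exact hw j
        · exact le_rfl
  omega

/-- Repeating a distribution over trees with abstention until it answers. -/
theorem exists_penalized_ge {ι J : Type} [Fintype J] (X : Set (ι → Bool))
    (f : (ι → Bool) → Bool) (κ : ℝ) (w : J → ℝ) (hw : ∀ j, 0 ≤ w j) (hw1 : ∑ j, w j = 1)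
    (t : J → DTree ι (Option Bool))
    (hpos : ∀ x ∈ X, 0 < ∑ j, w j * (netGain (21 / 20) (κ / 2) f (t j) x - 1)) (N : ℕ) :
    ∃ u ∈ convexHull ℝ (Set.range (penalized κ f)), ∀ x ∈ X,
      9 / 10 * (1 - (∑ j, w j * if ((t j).out x).isNone then 1 else 0) ^ N) ≤ u x := by
  induction N with
  | zero =>
    refine ⟨_, subset_convexHull ℝ _ ⟨.leaf false, rfl⟩, fun x _ => ?_⟩
    simp only [penalized, cost]
    split_ifs <;> norm_num
  | succ N ih =>
    obtain ⟨u, hu, hux⟩ := ih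
    set a : J → (ι → Bool) → ℝ := fun j x =>
      (if (t j).out x = some (f x) then 1 else 0) - κ * (t j).cost x with ha
    set ν : J → (ι → Bool) → ℝ := fun j x => if ((t j).out x).isNone then 1 else 0 with hν
    have hstep : ∀ j, a j + ν j * u ∈ convexHull ℝ (Set.range (penalized κ f)) := by
      intro j
      obtain ⟨K, _, p, z, hp, hp1, hz, rfl⟩ := mem_convexHull_iff_exists_fintype.1 hu
      choose s hs using hz
      refine mem_convexHull_of_exists_fintype p (fun k => penalized κ f ((t j).orElse (s k)))
        hp hp1 (fun k => ⟨_, rfl⟩) ?_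
      funext x
      have : ∀ k, penalized κ f ((t j).orElse (s k)) x = a j x + ν j x * z k x := by
        intro k
        rw [← hs]
        simp only [penalized, ha, hν, out_orElse, cost_orElse]
        cases (t j).out x <;> simp; ring
      simp only [Finset.sum_apply, Pi.smul_apply, smul_eq_mul, Pi.add_apply, Pi.mul_apply, this,
        mul_add, Finset.sum_add_distrib, ← Finset.sum_mul, hp1, one_mul, Finset.mul_sum]
      congr 1
      exact Finset.sum_congr rfl fun k _ => by ring
    refine ⟨∑ j, w j • (a j + ν j * u),
      (convex_convexHull ℝ _).sum_mem (fun j _ => hw j) hw1 (fun j _ => hstep j), fun x hx => ?_⟩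
    set Q := ∑ j, w j * ν j x with hQ
    have hQ0 : 0 ≤ Q := Finset.sum_nonneg fun j _ => mul_nonneg (hw j) (by
      simp only [hν]; split_ifs <;> norm_num)
    have hsplit : (∑ j, w j • (a j + ν j * u)) x = ∑ j, w j * a j x + Q * u x := by
      simp only [Finset.sum_apply, Pi.smul_apply, smul_eq_mul, Pi.add_apply, Pi.mul_apply,
        mul_add, Finset.sum_add_distrib, hQ, Finset.sum_mul, mul_assoc]
    have hpt : ∀ j, 2 * (netGain (21 / 20) (κ / 2) f (t j) x - 1) + 9 / 10 * (1 - ν j x)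
        ≤ a j x := by
      intro j
      simp only [netGain, gain, ha, hν]
      rcases (t j).out x with _ | c
      · simp; linarith
      · by_cases h : c = f x
        · simp [h]; linarith
        · simp [h]; linarith
    have hA : 9 / 10 * (1 - Q) ≤ ∑ j, w j * a j x := by
      have h1 : ∑ j, w j * (2 * (netGain (21 / 20) (κ / 2) f (t j) x - 1)
          + 9 / 10 * (1 - ν j x)) ≤ ∑ j, w j * a j x :=
        Finset.sum_le_sum fun j _ => mul_le_mul_of_nonneg_left (hpt j) (hw j)
      have h2 : ∑ j, w j * (2 * (netGain (21 / 20) (κ / 2) f (t j) x - 1)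
          + 9 / 10 * (1 - ν j x))
          = 2 * (∑ j, w j * (netGain (21 / 20) (κ / 2) f (t j) x - 1))
            + 9 / 10 * (∑ j, w j - Q) := by
        rw [hQ, ← Finset.sum_sub_distrib, Finset.mul_sum, Finset.mul_sum,
          ← Finset.sum_add_distrib]
        exact Finset.sum_congr rfl fun j _ => by ring
      rw [h2, hw1] at h1
      linarith [hpos x hx]
    rw [hsplit, pow_succ]
    have := mul_le_mul_of_nonneg_left (hux x hx) hQ0
    change 9 / 10 * (1 - Q ^ N * Q) ≤ _
    have h3 : Q * (9 / 10 * (1 - Q ^ N)) ≤ Q * u x := this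
    linarith

/-- If `f` has positive randomized query complexity `r`, then under some distribution on its
domain no decision tree makes a profit at the price of `1 / (2 r)` per query. -/
theorem exists_hard_distribution {ι : Type} [Fintype ι] [DecidableEq ι] (X : Set (ι → Bool))
    (f : (ι → Bool) → Bool) (hr : 0 < Rwc X f (2 / 3)) :
    ∃ μ : InputDist ι X, ∀ t : DTree ι (Option Bool),
      ∑ x, μ.μ x * netGain (21 / 20) ((Rwc X f (2 / 3) : ℝ)⁻¹ / 2) f t x ≤ 1 := by
  set r := Rwc X f (2 / 3) with hr_def
  rcases exists_prob_nonpos_or_exists_pos X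
    (Set.range fun (t : DTree ι (Option Bool)) x =>
      netGain (21 / 20) ((r : ℝ)⁻¹ / 2) f t x - 1)
    ⟨.leaf none, by funext x; simp [netGain, gain, out, cost]⟩ with
    ⟨μ, h0, h1, hX, hle⟩ | ⟨v, hv, hvpos⟩
  · refine ⟨⟨μ, h0, h1, hX⟩, fun t => ?_⟩
    have := hle _ ⟨t, rfl⟩
    simp only [mul_sub, mul_one, Finset.sum_sub_distrib, h1] at this
    linarith
  · exfalso
    obtain ⟨J, _, w, z, hw, hw1, hz, rfl⟩ := mem_convexHull_iff_exists_fintype.1 hv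
    choose t ht using hz
    have hpos : ∀ x ∈ X, 0 < ∑ j, w j * (netGain (21 / 20) ((r : ℝ)⁻¹ / 2) f (t j) x - 1) := by
      intro x hx
      simpa [← ht] using hvpos x hx
    have hev : ∀ᶠ N : ℕ in Filter.atTop, ∀ x, x ∈ X →
        (∑ j, w j * if ((t j).out x).isNone then (1 : ℝ) else 0) ^ N < 1 / 10 := by
      rw [Filter.eventually_all]
      intro x
      by_cases hx : x ∈ X
      · have hlt : (∑ j, w j * if ((t j).out x).isNone then (1 : ℝ) else 0) < 1 := by
          have hle : ∑ j, w j * (netGain (21 / 20) ((r : ℝ)⁻¹ / 2) f (t j) x - 1) ≤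
              ∑ j, (w j - w j * if ((t j).out x).isNone then (1 : ℝ) else 0) := by
            refine Finset.sum_le_sum fun j _ => ?_
            rw [← mul_one_sub]
            refine mul_le_mul_of_nonneg_left ?_ (hw j)
            have : (0 : ℝ) ≤ (r : ℝ)⁻¹ / 2 * (t j).cost x := by positivity
            simp only [netGain, gain]
            rcases (t j).out x with _ | c
            · simp; linarith
            · simp only [Option.isNone_some]
              split_ifs <;> norm_num at * <;> linarith
          rw [Finset.sum_sub_distrib, hw1] at hle
          linarith [hpos x hx]
        have h0 : 0 ≤ (∑ j, w j * if ((t j).out x).isNone then (1 : ℝ) else 0) :=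
          Finset.sum_nonneg fun j _ => mul_nonneg (hw j) (by split_ifs <;> norm_num)
        filter_upwards [(tendsto_pow_atTop_nhds_zero_of_lt_one h0 hlt).eventually_lt_const
          (by norm_num : (0 : ℝ) < 1 / 10)] with N hN _ using hN
      · exact Filter.Eventually.of_forall fun N h => absurd h hx
    obtain ⟨N, hN⟩ := hev.exists
    obtain ⟨u, hu, hux⟩ := exists_penalized_ge X f (r : ℝ)⁻¹ w hw hw1 t hpos N
    exact absurd (Rwc_lt_of_penalized X f (2 / 3) hr u hu fun x hx => by
      linarith [hux x hx, hN x hx]) (lt_irrefl _)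

end HardDistribution

section Potential

open DTree

/-- Restriction of the weight `ν` to the inputs whose bit `i` is `b`. -/
def restrictBit {ι : Type} (ν : (ι → Bool) → ℝ) (i : ι) (b : Bool) (x : ι → Bool) : ℝ :=
  if x i = b then ν x else 0

theorem restrictBit_nonneg {ι : Type} {ν : (ι → Bool) → ℝ} (hν : ∀ x, 0 ≤ ν x) (i : ι) (b : Bool)
    (x : ι → Bool) : 0 ≤ restrictBit ν i b x := by
  unfold restrictBit
  split_ifs
  · exact hν x
  · exact le_rfl

variable {ι : Type} [Fintype ι] [DecidableEq ι]

/-- Best expected net gain of a decision tree against the weight `ν`. -/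
noncomputable def bestGain (lam α : ℝ) (f : (ι → Bool) → Bool) (ν : (ι → Bool) → ℝ) : ℝ :=
  ⨆ t : DTree ι (Option Bool), ∑ x, ν x * netGain lam α f t x

theorem le_bestGain {lam α : ℝ} (hlam : 1 ≤ lam) (hα : 0 ≤ α) (f : (ι → Bool) → Bool)
    {ν : (ι → Bool) → ℝ} (hν : ∀ x, 0 ≤ ν x) (t : DTree ι (Option Bool)) :
    ∑ x, ν x * netGain lam α f t x ≤ bestGain lam α f ν := by
  refine le_ciSup (f := fun t => ∑ x, ν x * netGain lam α f t x) ⟨∑ x, ν x * lam, ?_⟩ t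
  rintro _ ⟨s, rfl⟩
  refine Finset.sum_le_sum fun x _ => mul_le_mul_of_nonneg_left ?_ (hν x)
  have : 0 ≤ α * (s.cost x : ℝ) := by positivity
  simp only [netGain, gain]
  rcases s.out x with _ | c
  · simp; linarith
  · simp only
    split_ifs <;> linarith

theorem sum_le_bestGain {lam α : ℝ} (hlam : 1 ≤ lam) (hα : 0 ≤ α) (f : (ι → Bool) → Bool)
    {ν : (ι → Bool) → ℝ} (hν : ∀ x, 0 ≤ ν x) : ∑ x, ν x ≤ bestGain lam α f ν := by
  simpa [netGain, gain, out, cost] using le_bestGain hlam hα f hν (.leaf none)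

theorem mul_sum_le_bestGain {lam α : ℝ} (hlam : 1 ≤ lam) (hα : 0 ≤ α)
    (f : (ι → Bool) → Bool) {ν : (ι → Bool) → ℝ} (hν : ∀ x, 0 ≤ ν x) (b : Bool) :
    lam * ∑ x, ν x * (if f x = b then 1 else 0) ≤ bestGain lam α f ν := by
  refine le_trans (le_of_eq ?_) (le_bestGain hlam hα f hν (.leaf (some b)))
  rw [Finset.mul_sum]
  refine Finset.sum_congr rfl fun x _ => ?_
  by_cases h : f x = b
  · simp [netGain, gain, out, cost, h, mul_comm]
  · simp [netGain, gain, out, cost, h, Ne.symm h]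

theorem bestGain_restrictBit_add_le {lam α : ℝ} (hlam : 1 ≤ lam) (hα : 0 ≤ α)
    (f : (ι → Bool) → Bool) {ν : (ι → Bool) → ℝ} (hν : ∀ x, 0 ≤ ν x) (i : ι) :
    bestGain lam α f (restrictBit ν i false) + bestGain lam α f (restrictBit ν i true) ≤
      (1 + α) * bestGain lam α f ν := by
  have : Nonempty (DTree ι (Option Bool)) := ⟨.leaf none⟩
  rw [← le_sub_iff_add_le]
  refine ciSup_le fun t0 => ?_
  rw [le_sub_comm]
  refine ciSup_le fun t1 => ?_
  rw [le_sub_iff_add_le]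
  have h1 := le_bestGain hlam hα f hν (.node i t0 t1)
  have h2 := mul_le_mul_of_nonneg_left (sum_le_bestGain hlam hα f hν) hα
  have h3 : ∑ x, restrictBit ν i true x * netGain lam α f t1 x
      + ∑ x, restrictBit ν i false x * netGain lam α f t0 x
      = ∑ x, ν x * netGain lam α f (.node i t0 t1) x + α * ∑ x, ν x := by
    rw [← Finset.sum_add_distrib, Finset.mul_sum, ← Finset.sum_add_distrib]
    refine Finset.sum_congr rfl fun x _ => ?_
    cases h : x i <;> simp [restrictBit, netGain, out, cost, h] <;> ring
  linarith

end Potential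

section DirectProduct

variable {m n : ℕ}

/-- The output `z` makes no mistake on the `n`-fold product input `x`. -/
def labelGood (f : (Fin m → Bool) → Bool) (x : Fin n × Fin m → Bool)
    (z : Fin n → Option Bool) : Prop :=
  ∀ i b, z i = some b → fpow f x i = b

theorem sum_prod_block (g : Fin n → (Fin m → Bool) → ℝ) :
    ∑ x : Fin n × Fin m → Bool, ∏ i, g i (block x i) = ∏ i, ∑ y, g i y := by
  rw [Finset.prod_univ_sum, Fintype.piFinset_univ]
  exact (Equiv.curry (Fin n) (Fin m) Bool).sum_comp fun y => ∏ i, g i (y i)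

open Classical in
theorem pow_mul_sum_labelGood_le {lam α : ℝ} (hlam : 1 ≤ lam) (hα : 0 ≤ α)
    (f : (Fin m → Bool) → Bool) {k : ℕ} (t : DTree (Fin n × Fin m) (Fin n → Option Bool))
    (ht : t.allLabels fun z => (Finset.univ.filter fun i => (z i).isSome).card = k)
    (ν : Fin n → (Fin m → Bool) → ℝ) (hν : ∀ i y, 0 ≤ ν i y) :
    lam ^ k * ∑ x : Fin n × Fin m → Bool,
        (∏ i, ν i (block x i)) * (if labelGood f x (t.out x) then 1 else 0) ≤
      (1 + α) ^ t.depth * ∏ i, bestGain lam α f (ν i) := by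
  have hbest : ∀ {ρ : (Fin m → Bool) → ℝ}, (∀ y, 0 ≤ ρ y) → 0 ≤ bestGain lam α f ρ :=
    fun h => (Finset.sum_nonneg fun y _ => h y).trans (sum_le_bestGain hlam hα f h)
  induction t generalizing ν with
  | leaf z =>
    simp only [DTree.allLabels] at ht
    simp only [DTree.depth, pow_zero, one_mul]
    have h1 : ∀ x : Fin n × Fin m → Bool,
        (∏ i, ν i (block x i)) * (if labelGood f x ((DTree.leaf z).out x) then (1 : ℝ) else 0) =
          ∏ i, ν i (block x i) * (if ∀ b, z i = some b → f (block x i) = b then 1 else 0) := by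
      intro x
      rw [Finset.prod_mul_distrib, Finset.prod_ite_zero]
      simp [labelGood, fpow, DTree.out]
    have h2 : lam ^ k = ∏ i, if (z i).isSome then lam else 1 := by
      rw [Finset.prod_ite]
      simp [ht]
    simp only [h1]
    rw [sum_prod_block fun i y => ν i y * if ∀ b, z i = some b → f y = b then 1 else 0, h2,
      ← Finset.prod_mul_distrib]
    refine Finset.prod_le_prod (fun i _ => mul_nonneg (by split_ifs <;> linarith)
      (Finset.sum_nonneg fun y _ => mul_nonneg (hν i y) (by split_ifs <;> norm_num)))
      fun i _ => ?_
    rcases hz : z i with _ | b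
    · simpa using sum_le_bestGain hlam hα f (hν i)
    · simpa using mul_sum_le_bestGain hlam hα f (hν i) b
  | node q t0 t1 h0 h1 =>
    obtain ⟨i, j⟩ := q
    set ρ : Bool → Fin n → (Fin m → Bool) → ℝ := fun b =>
      Function.update ν i (restrictBit (ν i) j b) with hρ
    have hρ0 : ∀ b l y, 0 ≤ ρ b l y := by
      intro b l y
      by_cases h : l = i
      · subst h
        simpa [hρ] using restrictBit_nonneg (hν l) j b y
      · simpa [hρ, h] using hν l y
    have hprod : ∀ (b : Bool) (x : Fin n × Fin m → Bool), ∏ l, ρ b l (block x l) =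
        if x (i, j) = b then ∏ l, ν l (block x l) else 0 := by
      intro b x
      by_cases h : x (i, j) = b
      · rw [if_pos h]
        refine Finset.prod_congr rfl fun l _ => ?_
        by_cases hl : l = i
        · subst hl
          simp [hρ, restrictBit, block, h]
        · simp [hρ, hl]
      · rw [if_neg h]
        exact Finset.prod_eq_zero (Finset.mem_univ i) (by simp [hρ, restrictBit, block, h])
    have hbestprod : ∀ b, ∏ l, bestGain lam α f (ρ b l) =
        bestGain lam α f (restrictBit (ν i) j b)
          * ∏ l ∈ Finset.univ.erase i, bestGain lam α f (ν l) := by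
      intro b
      rw [← Finset.mul_prod_erase _ _ (Finset.mem_univ i)]
      congr 1
      · simp [hρ]
      · refine Finset.prod_congr rfl fun l hl => ?_
        simp [hρ, Finset.ne_of_mem_erase hl]
    have e0 := h0 ht.1 (ρ false) (hρ0 false)
    have e1 := h1 ht.2 (ρ true) (hρ0 true)
    rw [hbestprod] at e0 e1
    have hsum : ∑ x : Fin n × Fin m → Bool, (∏ l, ν l (block x l)) *
          (if labelGood f x ((DTree.node (i, j) t0 t1).out x) then (1 : ℝ) else 0) =
        (∑ x : Fin n × Fin m → Bool, (∏ l, ρ false l (block x l)) *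
          if labelGood f x (t0.out x) then (1 : ℝ) else 0) +
        ∑ x : Fin n × Fin m → Bool, (∏ l, ρ true l (block x l)) *
          if labelGood f x (t1.out x) then (1 : ℝ) else 0 := by
      rw [← Finset.sum_add_distrib]
      refine Finset.sum_congr rfl fun x _ => ?_
      rw [hprod, hprod]
      cases h : x (i, j) <;> simp [DTree.out, h]
    set E := ∏ l ∈ Finset.univ.erase i, bestGain lam α f (ν l) with hE
    have hE0 : 0 ≤ E := Finset.prod_nonneg fun l _ => hbest (hν l)
    have hB : ∀ b, 0 ≤ bestGain lam α f (restrictBit (ν i) j b) * E := fun b =>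
      mul_nonneg (hbest (restrictBit_nonneg (hν i) j b)) hE0
    have h1α : 1 ≤ 1 + α := by linarith
    set d := max t0.depth t1.depth with hd
    have p0 := mul_le_mul_of_nonneg_right
      (pow_le_pow_right₀ h1α (le_max_left t0.depth t1.depth)) (hB false)
    have p1 := mul_le_mul_of_nonneg_right
      (pow_le_pow_right₀ h1α (le_max_right t0.depth t1.depth)) (hB true)
    rw [hsum, mul_add, ← Finset.mul_prod_erase _ _ (Finset.mem_univ i), ← hE]
    have hfin := mul_le_mul_of_nonneg_left
      (mul_le_mul_of_nonneg_right (bestGain_restrictBit_add_le hlam hα f (hν i) j) hE0)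
      (pow_nonneg (by linarith : 0 ≤ 1 + α) d)
    calc _ ≤ (1 + α) ^ d * (bestGain lam α f (restrictBit (ν i) j false) * E)
          + (1 + α) ^ d * (bestGain lam α f (restrictBit (ν i) j true) * E) :=
        add_le_add (e0.trans p0) (e1.trans p1)
      _ ≤ (1 + α) ^ d * ((1 + α) * bestGain lam α f (ν i) * E) := by linarith
      _ = _ := by rw [DTree.depth, pow_succ]; ring

/-- The minimum defining `RwcLabel` is attained. -/
theorem exists_alg_depth_le_RwcLabel (X : Set (Fin m → Bool)) (f : (Fin m → Bool) → Bool)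
    {k : ℕ} (hk : k ≤ n) {δ : ℝ} (hδ : δ ≤ 1) :
    open Classical in
    ∃ R : RandAlg (Fin n × Fin m) (Fin n → Option Bool),
      (∀ j, R.p j ≠ 0 → (R.T j).allLabels fun z =>
        (Finset.univ.filter fun i => (z i).isSome).card = k) ∧
      (∀ x ∈ Xpow n X, δ ≤ ∑ j, if labelGood f x ((R.T j).out x) then R.p j else 0) ∧
      ∀ j, R.p j ≠ 0 → (R.T j).depth ≤ RwcLabel X f n k δ := by
  classical
  obtain ⟨K, hK⟩ : ∃ K : Finset (Fin n), K.card = k := by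
    obtain ⟨K, -, hK⟩ := Finset.exists_subset_card_eq
      (s := (Finset.univ : Finset (Fin n))) (n := k) (by simpa using hk)
    exact ⟨K, hK⟩
  obtain ⟨t, ht, hout⟩ := DTree.exists_out_eq
    (fun (x : Fin n × Fin m → Bool) i => if i ∈ K then some (fpow f x i) else none)
    (fun z : Fin n → Option Bool => (Finset.univ.filter fun i => (z i).isSome).card = k)
    (fun x => by
      rw [← hK]
      congr 1
      ext i
      by_cases h : i ∈ K <;> simp [h])
  have hmem := Nat.sInf_mem (s := {d : ℕ | ∃ R : RandAlg (Fin n × Fin m) (Fin n → Option Bool),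
      (∀ j, R.p j ≠ 0 → (R.T j).allLabels fun z =>
        (Finset.univ.filter fun i => (z i).isSome).card = k) ∧
      (∀ x ∈ Xpow n X, δ ≤ ∑ j, if labelGood f x ((R.T j).out x) then R.p j else 0) ∧
      ∀ j, R.p j ≠ 0 → (R.T j).depth ≤ d})
    ⟨t.depth, ⟨1, fun _ => 1, fun _ => t, fun _ => zero_le_one, by simp⟩, fun _ _ => ht, ?_,
      fun _ _ => le_rfl⟩
  · obtain ⟨R, h1, h2, h3⟩ := hmem
    refine ⟨R, h1, h2, fun j hj => (h3 j hj).trans (le_of_eq ?_)⟩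
    unfold RwcLabel RwcTask labelGood
    congr!
  · intro x _
    have : labelGood f x (t.out x) := by
      intro i b hb
      rw [hout] at hb
      by_cases h : i ∈ K <;> simp [h] at hb
      exact hb
    simpa [this] using hδ

end DirectProduct
/-- A labelled threshold algorithm of depth `d` succeeds with probability at most
`(1 + α)^d / lam^k` when no tree profits against `μ` at the price of `α` per query. -/
theorem mul_pow_le_of_hard_distribution {m n k : ℕ} (X : Set (Fin m → Bool))
    (f : (Fin m → Bool) → Bool) (hk : k ≤ n) {δ lam α : ℝ} (hδ : δ ≤ 1) (hlam : 1 ≤ lam)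
    (hα : 0 ≤ α) (μ : InputDist (Fin m) X)
    (hμ : ∀ t : DTree (Fin m) (Option Bool), ∑ x, μ.μ x * t.netGain lam α f x ≤ 1) :
    lam ^ k * δ ≤ (1 + α) ^ RwcLabel X f n k δ := by
  classical
  obtain ⟨R, hlab, hsucc, hdepth⟩ := exists_alg_depth_le_RwcLabel (n := n) X f hk hδ
  set T := RwcLabel X f n k δ with hT
  have : Nonempty (DTree (Fin m) (Option Bool)) := ⟨.leaf none⟩
  have hbest : bestGain lam α f μ.μ ≤ 1 := ciSup_le hμ
  have hbest0 : 0 ≤ bestGain lam α f μ.μ :=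
    (Finset.sum_nonneg fun y _ => μ.nonneg y).trans (sum_le_bestGain hlam hα f μ.nonneg)
  have hprodnn : ∀ x : Fin n × Fin m → Bool, 0 ≤ ∏ i, μ.μ (block x i) :=
    fun x => Finset.prod_nonneg fun i _ => μ.nonneg _
  have hmass : ∑ x : Fin n × Fin m → Bool, ∏ i, μ.μ (block x i) = 1 := by
    rw [sum_prod_block fun _ => μ.μ]
    simp [μ.sum_one]
  have hlow : δ ≤ ∑ x : Fin n × Fin m → Bool, (∏ i, μ.μ (block x i)) *
      ∑ j, (if labelGood f x ((R.T j).out x) then R.p j else 0) := by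
    calc δ = ∑ x : Fin n × Fin m → Bool, (∏ i, μ.μ (block x i)) * δ := by
          rw [← Finset.sum_mul, hmass, one_mul]
      _ ≤ _ := Finset.sum_le_sum fun x _ => by
          by_cases hx : x ∈ Xpow n X
          · exact mul_le_mul_of_nonneg_left (hsucc x hx) (hprodnn x)
          · obtain ⟨i, hi⟩ : ∃ i, block x i ∉ X := by simpa [Xpow] using hx
            rw [Finset.prod_eq_zero (Finset.mem_univ i) (μ.supp _ hi)]
            simp
  have hswap : ∑ x : Fin n × Fin m → Bool, (∏ i, μ.μ (block x i)) *
      ∑ j, (if labelGood f x ((R.T j).out x) then R.p j else 0) =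
      ∑ j, R.p j * ∑ x : Fin n × Fin m → Bool, (∏ i, μ.μ (block x i)) *
        (if labelGood f x ((R.T j).out x) then 1 else 0) := by
    simp only [Finset.mul_sum]
    rw [Finset.sum_comm]
    refine Finset.sum_congr rfl fun j _ => Finset.sum_congr rfl fun x _ => ?_
    split_ifs <;> ring
  have hlam0 : 0 ≤ lam ^ k := by positivity
  calc lam ^ k * δ ≤ lam ^ k * _ := mul_le_mul_of_nonneg_left (hlow.trans_eq hswap) hlam0
    _ = ∑ j, R.p j * (lam ^ k * ∑ x : Fin n × Fin m → Bool, (∏ i, μ.μ (block x i)) *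
        (if labelGood f x ((R.T j).out x) then 1 else 0)) := by
        rw [Finset.mul_sum]
        exact Finset.sum_congr rfl fun j _ => by ring
    _ ≤ ∑ j, R.p j * (1 + α) ^ T := Finset.sum_le_sum fun j _ => by
        by_cases hj : R.p j = 0
        · simp [hj]
        · refine mul_le_mul_of_nonneg_left ?_ (R.p_nonneg j)
          refine (pow_mul_sum_labelGood_le hlam hα f (R.T j) (hlab j hj) (fun _ => μ.μ)
            fun _ => μ.nonneg).trans ?_
          have h1 : ∏ _i : Fin n, bestGain lam α f μ.μ ≤ 1 :=
            Finset.prod_le_one (fun _ _ => hbest0) fun _ _ => hbest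
          calc _ ≤ (1 + α) ^ (R.T j).depth * 1 := by gcongr
            _ ≤ (1 + α) ^ T := by
              rw [mul_one]
              exact pow_le_pow_right₀ (by linarith) (hdepth j hj)
    _ = (1 + α) ^ T := by rw [← Finset.sum_mul, R.p_sum, one_mul]

/-- **Labelled threshold direct product theorem**: there exist universal constants
`c ∈ (1/2,1)` and `c' > 0` such that `R_{γ^k}(Label_kⁿ ∘ f) ≥ c'·k·R(f)` for all
`γ ∈ [c,1)`. -/
theorem labelled_threshold_direct_product_theorem :
    ∃ c c' : ℝ, 1 / 2 < c ∧ c < 1 ∧ 0 < c' ∧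
      ∀ (m : ℕ) (X : Set (Fin m → Bool)) (f : (Fin m → Bool) → Bool) (n k : ℕ),
        1 ≤ k → k ≤ n → ∀ γ : ℝ, c ≤ γ → γ < 1 →
        c' * k * (Rwc X f (2 / 3) : ℝ) ≤ (RwcLabel X f n k (γ ^ k) : ℝ) := by
  refine ⟨41 / 42, 2 / 41, by norm_num, by norm_num, by norm_num, ?_⟩
  intro m X f n k _ hkn γ hγ hγ1
  rcases Nat.eq_zero_or_pos (Rwc X f (2 / 3)) with h0 | hr
  · simp [h0]
  obtain ⟨μ, hμ⟩ := exists_hard_distribution X f hr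
  set r := Rwc X f (2 / 3) with hr_def
  have hr' : (0 : ℝ) < r := Nat.cast_pos.2 hr
  have hmain := mul_pow_le_of_hard_distribution (n := n) X f hkn
    (pow_le_one₀ (by linarith) hγ1.le : γ ^ k ≤ 1) (by norm_num) (by positivity) μ hμ
  set T := RwcLabel X f n k (γ ^ k)
  have hlow : Real.exp (k * (1 / 41)) ≤ (21 / 20 : ℝ) ^ k * γ ^ k := by
    rw [← mul_pow, Real.exp_nat_mul]
    refine pow_le_pow_left₀ (Real.exp_pos _).le ?_ k
    have h1 : Real.exp (1 / 41) ≤ 41 / 40 := by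
      rw [← Real.le_log_iff_exp_le (by norm_num)]
      have := Real.one_sub_inv_le_log_of_pos (by norm_num : (0 : ℝ) < 41 / 40)
      norm_num at this ⊢
      linarith
    linarith
  have hupp : (1 + (r : ℝ)⁻¹ / 2) ^ T ≤ Real.exp (T * ((r : ℝ)⁻¹ / 2)) := by
    rw [Real.exp_nat_mul]
    refine pow_le_pow_left₀ (by positivity) ?_ T
    linarith [Real.add_one_le_exp ((r : ℝ)⁻¹ / 2)]
  have hexp := Real.exp_le_exp.1 (hlow.trans (hmain.trans hupp))
  have hmul := mul_le_mul_of_nonneg_right hexp hr'.le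
  have hcancel : (T : ℝ) * ((r : ℝ)⁻¹ / 2) * r = T / 2 := by
    field_simp
  rw [hcancel] at hmul
  linarith
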